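/- Let (E,j) and (Ẽ,j̃) be soft inductive systems of Banach spaces over the same directed set N, and let T_• be a uniformly bounded net of linear operators T_n : E_n → Ẽ_n (sup_n ‖T_n‖ < ∞) that maps every j-convergent net to a j̃-convergent net. Then there is a well-defined linear operator T_∞ : E_∞ → Ẽ_∞ with T_∞(j-lim_n x_n) = j̃-lim_n T_n x_n for every j-convergent net x_•, and ‖T_∞‖ ≤ limsup_n ‖T_n‖. -/

import Mathlib

open Filter Topology MeasureTheory

variable {N : Type*} [Preorder N] [IsDirected N (· ≤ ·)] [Nonempty N]
variable {E : N → Type*} [∀ n, NormedAddCommGroup (E n)] [∀ n, NormedSpace ℂ (E n)]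
  [∀ n, CompleteSpace (E n)]

/-- A *soft inductive system* of Banach spaces over the directed set `N`:
linear contractions `j n m : E m → E n` (for `n ≥ m`, with `j n n = id` and
`j n m = 0` when `¬ m ≤ n`), satisfying
`lim_m limsup_n ‖(j n l - j n m ∘ j m l) x‖ = 0` for all `l` and `x : E l`. -/
structure IsSoftInductiveSystem (j : ∀ n m : N, E m →L[ℂ] E n) : Prop where
  map_self : ∀ n, j n n = ContinuousLinearMap.id ℂ (E n)
  map_not_le : ∀ n m, ¬ m ≤ n → j n m = 0
  contraction : ∀ n m, m ≤ n → ∀ x : E m, ‖j n m x‖ ≤ ‖x‖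
  soft : ∀ (l : N) (x : E l),
    Tendsto (fun m => limsup (fun n => ‖j n l x - j n m (j m l x)‖) atTop)
      atTop (𝓝 0)

/-- A net `x = (x n)_{n ∈ N}` (with `x n ∈ E n`) is uniformly bounded. -/
def UniformlyBounded (x : ∀ n, E n) : Prop := ∃ C : ℝ, ∀ n, ‖x n‖ ≤ C

/-- The seminorm `|‖x‖| = limsup_n ‖x n‖` on uniformly bounded nets. -/
noncomputable def netSeminorm (x : ∀ n, E n) : ℝ := limsup (fun n => ‖x n‖) atTop

/-- The basic net `j_{• m} ξ` associated with `ξ ∈ E m`. -/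
def basicNet (j : ∀ n m : N, E m →L[ℂ] E n) (m : N) (ξ : E m) : ∀ n, E n :=
  fun n => j n m ξ

/-- A uniformly bounded net is `j`-convergent if it lies in the seminorm-closure of
the set of basic nets. -/
def JConvergent (j : ∀ n m : N, E m →L[ℂ] E n) (x : ∀ n, E n) : Prop :=
  UniformlyBounded x ∧
    ∀ ε : ℝ, 0 < ε → ∃ (m : N) (ξ : E m), netSeminorm (fun n => x n - j n m ξ) < ε

/-- A net is a null net if `lim_n ‖x n‖ = 0`. -/
def IsNullNet (x : ∀ n, E n) : Prop := Tendsto (fun n => ‖x n‖) atTop (𝓝 0)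

/-- A realization `(G, L)` of the limit space `E_∞ = C(E,j)/C₀(E,j)` of a soft inductive
system: `L` sends a `j`-convergent net to its `j`-limit; it is linear on `j`-convergent
nets, the norm of a `j`-limit is the seminorm of the net, and every element of `G`
arises as a `j`-limit. -/
structure IsLimitSpace (j : ∀ n m : N, E m →L[ℂ] E n) (G : Type*)
    [NormedAddCommGroup G] [NormedSpace ℂ G] (L : (∀ n, E n) → G) : Prop where
  map_add : ∀ x y, JConvergent j x → JConvergent j y → L (x + y) = L x + L y
  map_smul : ∀ (c : ℂ) (x), JConvergent j x → L (c • x) = c • L x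
  norm_eq : ∀ x, JConvergent j x → ‖L x‖ = netSeminorm x
  surjective : ∀ g : G, ∃ x, JConvergent j x ∧ L x = g

set_option linter.unusedSectionVars false

lemma UniformlyBounded.isBoundedUnder {x : ∀ n, E n} (hx : UniformlyBounded x) :
    IsBoundedUnder (· ≤ ·) atTop (fun n => ‖x n‖) :=
  let ⟨C, hC⟩ := hx
  isBoundedUnder_of ⟨C, hC⟩

lemma UniformlyBounded.add {x y : ∀ n, E n} (hx : UniformlyBounded x)
    (hy : UniformlyBounded y) : UniformlyBounded (x + y) := by
  obtain ⟨C, hC⟩ := hx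
  obtain ⟨D, hD⟩ := hy
  exact ⟨C + D, fun n => norm_add_le_of_le (hC n) (hD n)⟩

lemma UniformlyBounded.smul {x : ∀ n, E n} (c : ℂ) (hx : UniformlyBounded x) :
    UniformlyBounded (c • x) := by
  obtain ⟨C, hC⟩ := hx
  refine ⟨‖c‖ * C, fun n => ?_⟩
  rw [Pi.smul_apply, norm_smul]
  exact mul_le_mul_of_nonneg_left (hC n) (norm_nonneg c)

lemma UniformlyBounded.sub {x y : ∀ n, E n} (hx : UniformlyBounded x)
    (hy : UniformlyBounded y) : UniformlyBounded (fun n => x n - y n) := by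
  obtain ⟨C, hC⟩ := hx
  obtain ⟨D, hD⟩ := hy
  exact ⟨C + D, fun n => norm_sub_le_of_le (hC n) (hD n)⟩

lemma UniformlyBounded.eventually_norm_lt {x : ∀ n, E n} (hx : UniformlyBounded x) {ε : ℝ}
    (h : netSeminorm x < ε) : ∀ᶠ n in atTop, ‖x n‖ < ε :=
  eventually_lt_of_limsup_lt h hx.isBoundedUnder

lemma netSeminorm_nonneg {x : ∀ n, E n} (hx : UniformlyBounded x) : 0 ≤ netSeminorm x :=
  le_limsup_of_frequently_le (Frequently.of_forall fun n => norm_nonneg (x n)) hx.isBoundedUnder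

lemma netSeminorm_le_of_eventually_le {x : ∀ n, E n} {ε : ℝ}
    (h : ∀ᶠ n in atTop, ‖x n‖ ≤ ε) : netSeminorm x ≤ ε :=
  limsup_le_of_le (isCoboundedUnder_le_of_le atTop fun n => norm_nonneg (x n)) h

namespace IsSoftInductiveSystem

variable {j : ∀ n m : N, E m →L[ℂ] E n}

lemma uniformlyBounded_basicNet (hj : IsSoftInductiveSystem j) (m : N) (ξ : E m) :
    UniformlyBounded (basicNet j m ξ) := by
  refine ⟨‖ξ‖, fun n => ?_⟩
  by_cases h : m ≤ n
  · exact hj.contraction n m h ξ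
  · simp [basicNet, hj.map_not_le n m h]

/-- A basic net can be re-based at every sufficiently large index, up to an arbitrarily small
error. -/
lemma eventually_eventually_norm_sub_lt (hj : IsSoftInductiveSystem j) (l : N) (ξ : E l) {ε : ℝ}
    (hε : 0 < ε) :
    ∀ᶠ m in atTop, ∀ᶠ n in atTop, ‖j n l ξ - j n m (j m l ξ)‖ < ε := by
  filter_upwards [(hj.soft l ξ).eventually_lt_const hε] with m hm
  exact ((hj.uniformlyBounded_basicNet l ξ).sub
    (hj.uniformlyBounded_basicNet m (j m l ξ))).eventually_norm_lt hm

lemma jConvergent_iff (hj : IsSoftInductiveSystem j) {x : ∀ n, E n} :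
    JConvergent j x ↔ UniformlyBounded x ∧
      ∀ ε : ℝ, 0 < ε → ∃ (m : N) (ξ : E m), ∀ᶠ n in atTop, ‖x n - j n m ξ‖ < ε := by
  refine and_congr_right fun hx => ⟨fun h ε hε => ?_, fun h ε hε => ?_⟩
  · obtain ⟨m, ξ, hm⟩ := h ε hε
    exact ⟨m, ξ, (hx.sub (hj.uniformlyBounded_basicNet m ξ)).eventually_norm_lt hm⟩
  · obtain ⟨m, ξ, hm⟩ := h (ε / 2) (half_pos hε)
    exact ⟨m, ξ, (netSeminorm_le_of_eventually_le (hm.mono fun _ => le_of_lt)).trans_lt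
      (half_lt_self hε)⟩

lemma jConvergent_add (hj : IsSoftInductiveSystem j) {x y : ∀ n, E n} (hx : JConvergent j x)
    (hy : JConvergent j y) : JConvergent j (x + y) := by
  rw [hj.jConvergent_iff] at hx hy ⊢
  refine ⟨hx.1.add hy.1, fun ε hε => ?_⟩
  have hε' : 0 < ε / 5 := by positivity
  obtain ⟨k, ξ, hξ⟩ := hx.2 _ hε'
  obtain ⟨l, η, hη⟩ := hy.2 _ hε'
  obtain ⟨m, hk, hl⟩ := ((hj.eventually_eventually_norm_sub_lt k ξ hε').and
    (hj.eventually_eventually_norm_sub_lt l η hε')).exists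
  refine ⟨m, j m k ξ + j m l η, ?_⟩
  filter_upwards [hξ, hη, hk, hl] with n h₁ h₂ h₃ h₄
  have key : (x + y) n - j n m (j m k ξ + j m l η) =
      ((x n - j n k ξ) + (y n - j n l η)) +
        ((j n k ξ - j n m (j m k ξ)) + (j n l η - j n m (j m l η))) := by
    rw [Pi.add_apply, _root_.map_add]
    abel
  rw [key]
  linarith [norm_add_le_of_le (norm_add_le_of_le h₁.le h₂.le) (norm_add_le_of_le h₃.le h₄.le)]

lemma jConvergent_smul (hj : IsSoftInductiveSystem j) (c : ℂ) {x : ∀ n, E n}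
    (hx : JConvergent j x) : JConvergent j (c • x) := by
  rw [hj.jConvergent_iff] at hx ⊢
  refine ⟨hx.1.smul c, fun ε hε => ?_⟩
  have hc : 0 < ‖c‖ + 1 := by positivity
  obtain ⟨m, ξ, hm⟩ := hx.2 (ε / (‖c‖ + 1)) (by positivity)
  refine ⟨m, c • ξ, hm.mono fun n hn => ?_⟩
  rw [Pi.smul_apply, _root_.map_smul, ← smul_sub, norm_smul]
  rw [lt_div_iff₀ hc] at hn
  nlinarith [norm_nonneg (x n - j n m ξ), norm_nonneg c]

end IsSoftInductiveSystem

/-- The seminorm of the image of a net under a uniformly bounded net of operators. -/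
lemma netSeminorm_map_le {E' : N → Type*} [∀ n, NormedAddCommGroup (E' n)]
    [∀ n, NormedSpace ℂ (E' n)] [∀ n, CompleteSpace (E' n)] (T : ∀ n, E n →L[ℂ] E' n)
    (hT : UniformlyBounded T) {x : ∀ n, E n} (hx : UniformlyBounded x) :
    netSeminorm (fun n => T n (x n)) ≤ netSeminorm T * netSeminorm x := by
  refine le_mul_of_forall_lt₀ fun a ha b hb => netSeminorm_le_of_eventually_le ?_
  filter_upwards [hT.eventually_norm_lt ha, hx.eventually_norm_lt hb] with n hTn hxn
  exact (T n).le_of_opNorm_le_of_le hTn.le hxn.le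

/-- A uniformly bounded net of operators `T n : E n → Ẽ n` between
two soft inductive systems that maps `j`-convergent nets to `j̃`-convergent nets
induces a bounded linear operator `T_∞ : E_∞ → Ẽ_∞` with
`T_∞ (j-lim x) = j̃-lim (T n (x n))` and `‖T_∞‖ ≤ limsup_n ‖T n‖`. -/
theorem limit_operator_exists
    {E' : N → Type*} [∀ n, NormedAddCommGroup (E' n)] [∀ n, NormedSpace ℂ (E' n)]
    [∀ n, CompleteSpace (E' n)]
    (j : ∀ n m : N, E m →L[ℂ] E n) (j' : ∀ n m : N, E' m →L[ℂ] E' n)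
    (hj : IsSoftInductiveSystem j) (hj' : IsSoftInductiveSystem j')
    {G : Type*} [NormedAddCommGroup G] [NormedSpace ℂ G] [CompleteSpace G]
    (L : (∀ n, E n) → G) (hL : IsLimitSpace j G L)
    {G' : Type*} [NormedAddCommGroup G'] [NormedSpace ℂ G'] [CompleteSpace G']
    (L' : (∀ n, E' n) → G') (hL' : IsLimitSpace j' G' L')
    (T : ∀ n, E n →L[ℂ] E' n) (hTb : ∃ C : ℝ, ∀ n, ‖T n‖ ≤ C)
    (hTconv : ∀ x : ∀ n, E n, JConvergent j x →
      JConvergent j' (fun n => T n (x n))) :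
    ∃ Tinf : G →L[ℂ] G',
      (∀ x : ∀ n, E n, JConvergent j x →
        Tinf (L x) = L' (fun n => T n (x n))) ∧
      ‖Tinf‖ ≤ limsup (fun n => ‖T n‖) atTop := by
  have norm_le (x : ∀ n, E n) (hx : JConvergent j x) :
      ‖L' (fun n => T n (x n))‖ ≤ netSeminorm T * ‖L x‖ := by
    rw [hL.norm_eq x hx, hL'.norm_eq _ (hTconv x hx)]
    exact netSeminorm_map_le T hTb hx.1
  have map_add (x y : ∀ n, E n) (hx : JConvergent j x) (hy : JConvergent j y) :
      L' (fun n => T n ((x + y) n)) = L' (fun n => T n (x n)) + L' (fun n => T n (y n)) := by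
    rw [← hL'.map_add _ _ (hTconv x hx) (hTconv y hy)]
    exact congrArg L' (funext fun n => _root_.map_add (T n) (x n) (y n))
  have map_smul (c : ℂ) (x : ∀ n, E n) (hx : JConvergent j x) :
      L' (fun n => T n ((c • x) n)) = c • L' (fun n => T n (x n)) := by
    rw [← hL'.map_smul c _ (hTconv x hx)]
    exact congrArg L' (funext fun n => _root_.map_smul (T n) c (x n))
  have well_defined (x y : ∀ n, E n) (hx : JConvergent j x) (hy : JConvergent j y)
      (h : L x = L y) : L' (fun n => T n (x n)) = L' (fun n => T n (y n)) := by
    have hny : JConvergent j ((-1 : ℂ) • y) := hj.jConvergent_smul (-1) hy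
    have hle := norm_le _ (hj.jConvergent_add hx hny)
    rw [map_add x _ hx hny, map_smul (-1) y hy, hL.map_add x _ hx hny, hL.map_smul (-1) y hy, h,
      neg_one_smul, neg_one_smul, add_neg_cancel, norm_zero, mul_zero, norm_le_zero_iff,
      add_neg_eq_zero] at hle
    exact hle
  choose s hs hLs using hL.surjective
  refine ⟨LinearMap.mkContinuous
    { toFun := fun g => L' (fun n => T n (s g n))
      map_add' := fun g h => ?_
      map_smul' := fun c g => ?_ } (netSeminorm T) fun g => ?_, fun x hx => ?_,
    LinearMap.mkContinuous_norm_le _ (netSeminorm_nonneg hTb) _⟩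
  · rw [← map_add _ _ (hs g) (hs h)]
    refine well_defined _ _ (hs _) (hj.jConvergent_add (hs g) (hs h)) ?_
    rw [hL.map_add _ _ (hs g) (hs h), hLs, hLs, hLs]
  · rw [RingHom.id_apply, ← map_smul c _ (hs g)]
    refine well_defined _ _ (hs _) (hj.jConvergent_smul c (hs g)) ?_
    rw [hL.map_smul c _ (hs g), hLs, hLs]
  · exact (norm_le (s g) (hs g)).trans_eq (by rw [hLs])
  · exact well_defined _ _ (hs _) hx (hLs _)
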